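/- Let (W,S) be a finite Coxeter system and let e = u₁ <_β u₂ <_β … <_β u_k be a strict k-chain (k ≥ 2) in the BHZ order on W starting at the identity. Set w_i = u_k · u_i⁻¹ for 1 ≤ i ≤ k and let J' = S(u_{k−1}). Then for every i ≤ k−1, w_i lies in the coset w_{k−1} · W_{J'}; more precisely, the parabolic factorization of w_i with respect to W_{J'} is w_i = w_{k−1} · (u_{k−1} u_i⁻¹), i.e. (w_i)^{J'} = w_{k−1}, (w_i)_{J'} = u_{k−1} u_i⁻¹, and ℓ(w_i) = ℓ(w_{k−1}) + ℓ(u_{k−1} u_i⁻¹). -/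

import Mathlib

open scoped Classical

namespace ShardBHZ

variable {B : Type*} {W : Type*} [Group W] {M : CoxeterMatrix B} (cs : CoxeterSystem M W)

/-- The support `S(w)` of `w`: the set of simple reflections appearing in some
(equivalently, any) reduced word for `w`. -/
def supp (w : W) : Set B := {i | ∃ l : List B, cs.IsReduced l ∧ cs.wordProd l = w ∧ i ∈ l}

/-- The standard parabolic subgroup `W_I` generated by the simple reflections in `I`. -/
def parab (I : Set B) : Subgroup W := Subgroup.closure (cs.simple '' I)

/-- `x` has no right descent in `I`; this characterizes the minimal length coset
representatives `W^I` of `W / W_I`. -/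
def IsMinRep (I : Set B) (x : W) : Prop := ∀ i ∈ I, ¬ cs.IsRightDescent x i

/-- The BHZ order: `u ≤_β v` iff the parabolic component `v_{S(u)}` equals `u`, i.e.
`v = (v * u⁻¹) * u` is the parabolic factorization of `v` with respect to `W_{S(u)}`:
`u ∈ W_{S(u)}`, `v * u⁻¹` has no right descent in `S(u)`, and lengths add. -/
def bhzLE (u v : W) : Prop :=
  u ∈ parab cs (supp cs u) ∧ IsMinRep cs (supp cs u) (v * u⁻¹) ∧
    cs.length v = cs.length (v * u⁻¹) + cs.length u

/-- The set `N(w)` of left inversions of `w`. -/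
def invSet (w : W) : Set W := {t | cs.IsLeftInversion w t}

/-- The subgroup `G(w)` generated by `w * s * w⁻¹` for `s` a right descent of `w`. -/
def descConj (w : W) : Subgroup W :=
  Subgroup.closure {x | ∃ i, cs.IsRightDescent w i ∧ x = w * cs.simple i * w⁻¹}

/-- The shard intersection order: `u ≤_σ v` iff `N(u) ⊆ N(v)` and `G(u) ⊆ G(v)`. -/
def shardLE (u v : W) : Prop := invSet cs u ⊆ invSet cs v ∧ descConj cs u ≤ descConj cs v

/-- The parabolic component `w_I ∈ W_I` of `w` in the unique factorization
`w = w^I * w_I` with `w_I ∈ W_I`, `ℓ(w) = ℓ(w^I) + ℓ(w_I)` and `w^I` having no right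
descent in `I`. -/
noncomputable def pLow (I : Set B) (w : W) : W :=
  Classical.epsilon (fun u => u ∈ parab cs I ∧ IsMinRep cs I (w * u⁻¹) ∧
    cs.length w = cs.length (w * u⁻¹) + cs.length u)

/-- The minimal length coset representative `w^I = w * (w_I)⁻¹`. -/
noncomputable def pHigh (I : Set B) (w : W) : W := w * (pLow cs I w)⁻¹

open CoxeterSystem in
theorem even_count_leftInvSeq_alternatingWord (i j : B) (t : W) :
    Even ((cs.leftInvSeq (alternatingWord i j (2 * M i j))).count t) := by
  set l := cs.leftInvSeq (alternatingWord i j (2 * M i j)) with hl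
  have hlen : l.length = 2 * M i j := by simp [hl]
  have hdrop : l.drop (M i j) = l.take (M i j) := by
    apply List.ext_getElem
    · simp only [List.length_drop, List.length_take, hlen]; omega
    · intro n h₁ h₂
      have hn : n < M i j := by simp only [List.length_drop, hlen] at h₁; omega
      rw [List.getElem_drop, List.getElem_take]
      simp only [hl]
      rw [cs.getElem_leftInvSeq_alternatingWord i j _ _ (by omega),
        cs.getElem_leftInvSeq_alternatingWord i j _ _ (by omega),
        prod_alternatingWord_eq_mul_pow, prod_alternatingWord_eq_mul_pow,
        show (2 * (M i j + n) + 1) / 2 = M i j + n by omega,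
        show (2 * n + 1) / 2 = n by omega, pow_add, cs.simple_mul_simple_pow' i j]
      simp
  rw [← List.take_append_drop (M i j) l, hdrop, List.count_append]
  exact ⟨_, rfl⟩

/-- The action of a simple reflection on pairs of an element of `W` and a sign: conjugation on the
first component, and a change of sign exactly at the simple reflection itself. -/
noncomputable def signedConj (i : B) : Function.End (W × ZMod 2) := fun p =>
  (cs.simple i * p.1 * cs.simple i, p.2 + if p.1 = cs.simple i then 1 else 0)

theorem prod_map_signedConj_apply (ω : List B) (p : W × ZMod 2) :
    (ω.map (signedConj cs)).prod p = (cs.wordProd ω * p.1 * (cs.wordProd ω)⁻¹,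
      p.2 + (cs.rightInvSeq ω).count p.1) := by
  induction ω with
  | nil => ext <;> simp [Function.End.one_def]
  | cons i ω ih =>
    rw [List.map_cons, List.prod_cons]
    change signedConj cs i ((ω.map (signedConj cs)).prod p) = _
    rw [ih]
    have key : cs.wordProd ω * p.1 * (cs.wordProd ω)⁻¹ = cs.simple i ↔
        (cs.wordProd ω)⁻¹ * cs.simple i * cs.wordProd ω = p.1 := by
      constructor
      · intro h; rw [← h]; group
      · intro h; rw [← h]; group
    ext
    · simp [signedConj, CoxeterSystem.wordProd_cons, mul_assoc]
    · simp only [signedConj, CoxeterSystem.rightInvSeq, List.count_cons, key, beq_iff_eq]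
      split_ifs <;> simp [add_assoc]

open CoxeterSystem in
theorem prod_map_reverse_alternatingWord {G : Type*} [Monoid G] (f : B → G) (i j : B) (m : ℕ) :
    ((alternatingWord j i (2 * m)).reverse.map f).prod = (f i * f j) ^ m := by
  induction m with
  | zero => simp [alternatingWord]
  | succ m ih =>
    rw [show 2 * (m + 1) = 2 * m + 1 + 1 by ring, alternatingWord_succ, alternatingWord_succ]
    simp [← ih, pow_succ', mul_assoc]

theorem isLiftable_signedConj : M.IsLiftable (signedConj cs) := by
  intro i j
  rw [← prod_map_reverse_alternatingWord]
  funext p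
  rw [prod_map_signedConj_apply, cs.rightInvSeq_reverse, List.count_reverse]
  have hw : cs.wordProd (CoxeterSystem.alternatingWord j i (2 * M i j)).reverse = 1 := by
    rw [CoxeterSystem.wordProd, prod_map_reverse_alternatingWord, cs.simple_mul_simple_pow]
  have hc := even_count_leftInvSeq_alternatingWord cs j i p.1
  rw [M.symmetric j i, ← ZMod.natCast_eq_zero_iff_even] at hc
  rw [hw, hc]
  simp [Function.End.one_def]

theorem count_rightInvSeq_congr {ω ω' : List B} (h : cs.wordProd ω = cs.wordProd ω') (t : W) :
    ((cs.rightInvSeq ω).count t : ZMod 2) = (cs.rightInvSeq ω').count t := by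
  have key : ∀ η : List B, cs.lift ⟨_, isLiftable_signedConj cs⟩ (cs.wordProd η) =
      (η.map (signedConj cs)).prod := by
    intro η
    rw [CoxeterSystem.wordProd, map_list_prod, List.map_map]
    congr 2
    funext i
    exact cs.lift_apply_simple _ i
  have h' := congrFun ((key ω).symm.trans ((congrArg _ h).trans (key ω'))) (t, 0)
  rw [prod_map_signedConj_apply, prod_map_signedConj_apply] at h'
  simpa using congrArg Prod.snd h'

/-- The exchange property, for words which need not be reduced. -/
theorem exists_wordProd_eraseIdx_of_isRightDescent {ω : List B} {i : B}
    (h : cs.IsRightDescent (cs.wordProd ω) i) :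
    ∃ j < ω.length, cs.wordProd ω * cs.simple i = cs.wordProd (ω.eraseIdx j) := by
  obtain ⟨η, hη, hηw⟩ := cs.exists_isReduced (cs.wordProd ω * cs.simple i)
  have hprod : cs.wordProd (η.concat i) = cs.wordProd ω := by
    rw [cs.wordProd_concat, ← hηw, cs.simple_mul_simple_cancel_right]
  have hred : cs.IsReduced (η.concat i) := by
    have h₁ := cs.isRightDescent_iff.1 h
    rw [hηw, hη.eq] at h₁
    rw [CoxeterSystem.IsReduced, hprod, ← h₁]
    simp
  have hcount : (cs.rightInvSeq (η.concat i)).count (cs.simple i) = 1 :=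
    List.count_eq_one_of_mem hred.nodup_rightInvSeq (by rw [cs.rightInvSeq_concat]; simp)
  have hmem : cs.simple i ∈ cs.rightInvSeq ω := by
    by_contra hnot
    have h₂ := count_rightInvSeq_congr cs hprod (cs.simple i)
    rw [hcount, List.count_eq_zero_of_not_mem hnot] at h₂
    simp at h₂
  obtain ⟨j, hj, hji⟩ := List.getElem_of_mem hmem
  refine ⟨j, by simpa using hj, ?_⟩
  rw [← cs.wordProd_mul_getD_rightInvSeq, List.getD_eq_getElem _ _ hj, hji]

theorem simple_mem_parab {I : Set B} {i : B} (hi : i ∈ I) : cs.simple i ∈ parab cs I :=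
  Subgroup.subset_closure ⟨i, hi, rfl⟩

theorem wordProd_mem_parab {I : Set B} {ω : List B} (h : ∀ i ∈ ω, i ∈ I) :
    cs.wordProd ω ∈ parab cs I := by
  refine Subgroup.list_prod_mem _ fun x hx => ?_
  obtain ⟨i, hi, rfl⟩ := List.mem_map.1 hx
  exact simple_mem_parab cs (h i hi)

theorem exists_word_of_mem_parab {I : Set B} {y : W} (hy : y ∈ parab cs I) :
    ∃ ω : List B, (∀ i ∈ ω, i ∈ I) ∧ cs.wordProd ω = y := by
  induction hy using Subgroup.closure_induction with
  | mem x hx =>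
    obtain ⟨i, hi, rfl⟩ := hx
    exact ⟨[i], by simpa using hi, by simp⟩
  | one => exact ⟨[], by simp, by simp⟩
  | mul x y _ _ hx hy =>
    obtain ⟨ω, hω, rfl⟩ := hx
    obtain ⟨η, hη, rfl⟩ := hy
    refine ⟨ω ++ η, fun i hi => ?_, cs.wordProd_append _ _⟩
    exact (List.mem_append.1 hi).elim (hω i) (hη i)
  | inv x _ hx =>
    obtain ⟨ω, hω, rfl⟩ := hx
    exact ⟨ω.reverse, by simpa using hω, cs.wordProd_reverse ω⟩

theorem parab_mono {I J : Set B} (h : I ⊆ J) : parab cs I ≤ parab cs J :=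
  Subgroup.closure_mono (Set.image_mono h)

/-- A word in `I` that is shortest among the words in `I` with the same product adds its full
length to an element of minimal length in its coset of `W_I`. -/
theorem length_mul_wordProd {I : Set B} {x : W}
    (hx : ∀ r ∈ parab cs I, cs.length x ≤ cs.length (x * r)) (ω : List B) (hω : ∀ i ∈ ω, i ∈ I)
    (hmin : ∀ η : List B, (∀ i ∈ η, i ∈ I) → cs.wordProd η = cs.wordProd ω →
      ω.length ≤ η.length) :
    cs.length (x * cs.wordProd ω) = cs.length x + ω.length := by
  induction ω using List.reverseRecOn with
  | nil => simp
  | append_singleton ω i ih =>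
    have hωI : ∀ j ∈ ω, j ∈ I := fun j hj => hω j (by simp [hj])
    have hi : i ∈ I := hω i (by simp)
    have hlen := ih hωI fun η hη hprod => by
      have := hmin (η ++ [i]) (by simpa [or_imp, forall_and] using ⟨hη, hi⟩)
        (by rw [cs.wordProd_append, cs.wordProd_append, hprod])
      simpa using this
    rw [cs.wordProd_append, cs.wordProd_singleton, ← mul_assoc]
    by_cases hd : cs.IsRightDescent (x * cs.wordProd ω) i
    swap
    · rw [cs.not_isRightDescent_iff.1 hd, hlen]
      simp [add_assoc]
    exfalso
    obtain ⟨ξ, hξ, hξx⟩ := cs.exists_isReduced x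
    rw [hξx, ← cs.wordProd_append] at hd
    obtain ⟨j, hj, hjw⟩ := exists_wordProd_eraseIdx_of_isRightDescent cs hd
    by_cases hjξ : j < ξ.length
    · rw [List.eraseIdx_append_of_lt_length hjξ, cs.wordProd_append, cs.wordProd_append,
        ← hξx] at hjw
      have hy := wordProd_mem_parab cs hωI
      have h₁ := hx (cs.wordProd ω * cs.simple i * (cs.wordProd ω)⁻¹)
        (mul_mem (mul_mem hy (simple_mem_parab cs hi)) (inv_mem hy))
      have h₂ : x * (cs.wordProd ω * cs.simple i * (cs.wordProd ω)⁻¹) =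
          cs.wordProd (ξ.eraseIdx j) := by
        rw [← mul_inv_eq_iff_eq_mul.2 hjw]
        group
      have h₃ := cs.length_wordProd_le (ξ.eraseIdx j)
      have h₄ := hξ.eq
      rw [h₂] at h₁
      rw [← hξx] at h₄
      rw [List.length_eraseIdx_of_lt hjξ] at h₃
      omega
    · rw [List.eraseIdx_append_of_length_le (not_lt.1 hjξ), cs.wordProd_append, cs.wordProd_append,
        mul_assoc, mul_right_inj] at hjw
      have h₁ := hmin (ω.eraseIdx (j - ξ.length))
        (fun a ha => hωI a (List.mem_of_mem_eraseIdx ha))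
        (by rw [← hjw, cs.wordProd_append, cs.wordProd_singleton])
      have h₂ := List.length_eraseIdx_le ω (j - ξ.length)
      simp only [List.length_append, List.length_singleton] at h₁
      omega

theorem exists_isReduced_of_mem_parab {I : Set B} {y : W} (hy : y ∈ parab cs I) :
    ∃ ω : List B, (∀ i ∈ ω, i ∈ I) ∧ cs.wordProd ω = y ∧ cs.IsReduced ω ∧
      ∀ x : W, (∀ r ∈ parab cs I, cs.length x ≤ cs.length (x * r)) →
        cs.length (x * y) = cs.length x + cs.length y := by
  obtain ⟨ω, ⟨hω, rfl⟩, hmin⟩ := exists_minimalFor_of_wellFoundedLT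
    (fun ω : List B => (∀ i ∈ ω, i ∈ I) ∧ cs.wordProd ω = y) List.length
    (exists_word_of_mem_parab cs hy)
  have key : ∀ x : W, (∀ r ∈ parab cs I, cs.length x ≤ cs.length (x * r)) →
      cs.length (x * cs.wordProd ω) = cs.length x + ω.length := fun x hx =>
    length_mul_wordProd cs hx ω hω fun η hη hprod =>
      (le_total ω.length η.length).elim id fun h => hmin ⟨hη, hprod⟩ h
  have hred : cs.IsReduced ω := by
    simpa [CoxeterSystem.IsReduced] using key 1 (by simp)
  refine ⟨ω, hω, rfl, hred, fun x hx => ?_⟩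
  rw [key x hx, hred.eq]

variable {cs} in
theorem IsMinRep.length_le {I : Set B} {x : W} (hx : IsMinRep cs I x) {r : W}
    (hr : r ∈ parab cs I) : cs.length x ≤ cs.length (x * r) := by
  obtain ⟨y, hy, hmin⟩ := exists_minimalFor_of_wellFoundedLT
    (fun y : W => y ∈ parab cs I) (fun y => cs.length (x * y)) ⟨1, one_mem _⟩
  have hle : ∀ q ∈ parab cs I, cs.length (x * y) ≤ cs.length (x * q) := fun q hq =>
    (le_total (cs.length (x * y)) (cs.length (x * q))).elim id fun h => hmin hq h
  have hmin' : ∀ q ∈ parab cs I, cs.length (x * y) ≤ cs.length (x * y * q) := fun q hq => by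
    rw [mul_assoc]
    exact hle _ (mul_mem hy hq)
  obtain ⟨ω, hω, hωy, hred, hadd⟩ := exists_isReduced_of_mem_parab cs (inv_mem hy)
  rcases List.eq_nil_or_concat' ω with rfl | ⟨η, i, rfl⟩
  · rw [cs.wordProd_nil, eq_comm, inv_eq_one] at hωy
    simpa [hωy] using hle r hr
  exfalso
  have hi : i ∈ I := hω i (by simp)
  apply hx i hi
  have h₁ := hadd _ hmin'
  rw [← hωy, hred.eq, hωy, mul_inv_cancel_right] at h₁
  have hx' : x * cs.simple i = x * y * cs.wordProd η := by
    rw [cs.wordProd_append, cs.wordProd_singleton] at hωy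
    rw [← cs.simple_mul_simple_cancel_right (w := cs.wordProd η) i, hωy]
    group
  have h₂ := cs.length_mul_le (x * y) (cs.wordProd η)
  have h₃ := cs.length_wordProd_le η
  rw [CoxeterSystem.IsRightDescent, hx', h₁]
  simp only [List.length_append, List.length_singleton]
  omega

variable {cs} in
/-- Lengths add in a product of a minimal coset representative and an element of `W_I`. -/
theorem IsMinRep.length_mul {I : Set B} {x y : W} (hx : IsMinRep cs I x) (hy : y ∈ parab cs I) :
    cs.length (x * y) = cs.length x + cs.length y := by
  obtain ⟨-, -, -, -, h⟩ := exists_isReduced_of_mem_parab cs hy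
  exact h x fun _ => hx.length_le

variable {cs} in
theorem IsMinRep.eq_of_mul_eq_mul {I : Set B} {x x' y y' : W} (hx : IsMinRep cs I x)
    (hx' : IsMinRep cs I x') (hy : y ∈ parab cs I) (hy' : y' ∈ parab cs I)
    (h : x * y = x' * y') : y = y' := by
  have h₁ : x' = x * (y * y'⁻¹) := by rw [← mul_assoc, h, mul_inv_cancel_right]
  have hr : y * y'⁻¹ ∈ parab cs I := mul_mem hy (inv_mem hy')
  have h₂ := hx.length_mul hr
  have h₃ := hx'.length_le (inv_mem hr)
  rw [← h₁] at h₂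
  nth_rw 2 [h₁] at h₃
  rw [mul_inv_cancel_right] at h₃
  exact mul_inv_eq_one.1 (cs.length_eq_zero_iff.1 (by omega))

variable {cs} in
theorem IsMinRep.pLow_mul {I : Set B} {x y : W} (hx : IsMinRep cs I x) (hy : y ∈ parab cs I) :
    pLow cs I (x * y) = y := by
  obtain ⟨h₁, h₂, -⟩ := Classical.epsilon_spec (p := fun u => u ∈ parab cs I ∧
    IsMinRep cs I (x * y * u⁻¹) ∧ cs.length (x * y) = cs.length (x * y * u⁻¹) + cs.length u)
    ⟨y, hy, by rwa [mul_inv_cancel_right], by rw [mul_inv_cancel_right, hx.length_mul hy]⟩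
  exact h₂.eq_of_mul_eq_mul hx h₁ hy (inv_mul_cancel_right _ _)

theorem supp_subset_of_length_eq {u v : W}
    (h : cs.length v = cs.length (v * u⁻¹) + cs.length u) : supp cs u ⊆ supp cs v := by
  rintro i ⟨ω, hω, rfl, hi⟩
  obtain ⟨η, hη, hηv⟩ := cs.exists_isReduced (v * (cs.wordProd ω)⁻¹)
  have hv : cs.wordProd (η ++ ω) = v := by
    rw [cs.wordProd_append, ← hηv, inv_mul_cancel_right]
  refine ⟨η ++ ω, ?_, hv, by simp [hi]⟩
  rw [CoxeterSystem.IsReduced, hv, h, hηv, hη.eq, hω.eq, List.length_append]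

/-- Let `e = u₁ <_β ⋯ <_β u_k` (`k ≥ 2`) be a strict chain in the BHZ order starting at
the identity, `w_i = u_k * u_i⁻¹` and `J' = S(u_{k−1})`.  Then for `i ≤ k − 1`,
`w_i ∈ w_{k−1} W_{J'}` and, more precisely, the parabolic factorization of `w_i` with
respect to `W_{J'}` is `w_i = w_{k−1} · (u_{k−1} u_i⁻¹)`:
`(w_i)^{J'} = w_{k−1}`, `(w_i)_{J'} = u_{k−1} u_i⁻¹` and
`ℓ(w_i) = ℓ(w_{k−1}) + ℓ(u_{k−1} u_i⁻¹)`.  (Indices are `0`-based below, so the paper's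
`u_{k−1}`, `u_k` are `u ⟨k−2⟩`, `u ⟨k−1⟩`.) -/
theorem parabolic_factorization_of_chain [Finite W] (k : ℕ) (hk : 2 ≤ k)
    (u : Fin k → W) (h1 : u ⟨0, by omega⟩ = 1)
    (hc : ∀ i j : Fin k, i < j → bhzLE cs (u i) (u j) ∧ u i ≠ u j) :
    ∀ i : Fin k, (i : ℕ) ≤ k - 2 →
      (u ⟨k - 2, by omega⟩ * (u i)⁻¹ ∈ parab cs (supp cs (u ⟨k - 2, by omega⟩))) ∧
      IsMinRep cs (supp cs (u ⟨k - 2, by omega⟩))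
        (u ⟨k - 1, by omega⟩ * (u ⟨k - 2, by omega⟩)⁻¹) ∧
      cs.length (u ⟨k - 1, by omega⟩ * (u i)⁻¹) =
        cs.length (u ⟨k - 1, by omega⟩ * (u ⟨k - 2, by omega⟩)⁻¹) +
          cs.length (u ⟨k - 2, by omega⟩ * (u i)⁻¹) ∧
      pHigh cs (supp cs (u ⟨k - 2, by omega⟩)) (u ⟨k - 1, by omega⟩ * (u i)⁻¹) =
        u ⟨k - 1, by omega⟩ * (u ⟨k - 2, by omega⟩)⁻¹ ∧
      pLow cs (supp cs (u ⟨k - 2, by omega⟩)) (u ⟨k - 1, by omega⟩ * (u i)⁻¹) =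
        u ⟨k - 2, by omega⟩ * (u i)⁻¹ := by
  intro i hi
  set v := u ⟨k - 2, by omega⟩ with hv
  set w := u ⟨k - 1, by omega⟩ with hw
  obtain ⟨hvv, hmin, -⟩ := (hc ⟨k - 2, by omega⟩ ⟨k - 1, by omega⟩
    (Fin.mk_lt_mk.2 (by omega))).1
  rw [← hv] at hvv
  rw [← hv, ← hw] at hmin
  have hui : u i ∈ parab cs (supp cs v) := by
    rcases hi.lt_or_eq with hlt | heq
    · obtain ⟨h₁, -, h₂⟩ := (hc i ⟨k - 2, by omega⟩ (Fin.lt_def.2 hlt)).1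
      exact parab_mono cs (supp_subset_of_length_eq cs h₂) h₁
    · rwa [show u i = v from congrArg u (Fin.ext heq)]
  have hmem := mul_mem hvv (inv_mem hui)
  have hprod : w * (u i)⁻¹ = w * v⁻¹ * (v * (u i)⁻¹) := by group
  rw [hprod, pHigh, hmin.pLow_mul hmem]
  exact ⟨hmem, hmin, hmin.length_mul hmem, mul_inv_cancel_right _ _, rfl⟩

end ShardBHZ
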